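/- arXiv:math/0609325 — 2 statements merged into one kernel-verified Lean document; each statement's English description precedes it below -/
import Mathlib

section
/- For every real H > 0, the improper integral 2π ∫₀^∞ ( 1/4 − ((r²−1)/(r²+1))² ) · ( 16(1+4H²)(1+r²)² / ((r²−1)² + 4H²(r²+1)²)² ) · r dr converges and equals 16π − (4H² − 1/4) · A(H), where A(H) = 2π ( 1/H² + ((1+4H²)/(4H³)) ( π/2 − arctan((4H²−1)/(4H)) ) ). -/
open MeasureTheory Real Set Filter Topology

/-- The height component `(r² - 1) / (r² + 1)` of the inverse stereographic projection. -/
lemma hasDerivAt_stereographic_height (r : ℝ) :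
    HasDerivAt (fun r : ℝ => (r ^ 2 - 1) / (r ^ 2 + 1)) (4 * r / (r ^ 2 + 1) ^ 2) r := by
  have h : r ^ 2 + 1 ≠ 0 := by positivity
  refine (((hasDerivAt_pow 2 r).sub_const 1).div
    ((hasDerivAt_pow 2 r).add_const 1) h).congr_deriv ?_
  simp only [Nat.cast_ofNat, Nat.add_one_sub_one, pow_one]
  ring

lemma tendsto_stereographic_height_atTop :
    Tendsto (fun r : ℝ => (r ^ 2 - 1) / (r ^ 2 + 1)) atTop (𝓝 1) := by
  have h : Tendsto (fun r : ℝ => 1 - 2 / (r ^ 2 + 1)) atTop (𝓝 (1 - 0)) :=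
    tendsto_const_nhds.sub (tendsto_const_nhds.div_atTop
      (tendsto_atTop_add_const_right _ _ (tendsto_pow_atTop two_ne_zero)))
  rw [sub_zero] at h
  refine h.congr fun r => ?_
  have : r ^ 2 + 1 ≠ 0 := by positivity
  field_simp
  ring

/-- Integration of a nonnegative function of the height along a meridian. -/
lemma integral_comp_stereographic_height {K k : ℝ → ℝ} (hK : ∀ t, HasDerivAt K (k t) t)
    (hk : ∀ t, 0 ≤ k t) :
    IntegrableOn (fun r : ℝ => k ((r ^ 2 - 1) / (r ^ 2 + 1)) * (4 * r / (r ^ 2 + 1) ^ 2))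
        (Ioi 0) ∧
      ∫ r in Ioi (0 : ℝ), k ((r ^ 2 - 1) / (r ^ 2 + 1)) * (4 * r / (r ^ 2 + 1) ^ 2)
        = K 1 - K (-1) := by
  have hd : ∀ r ∈ Ici (0 : ℝ), HasDerivAt (fun r : ℝ => K ((r ^ 2 - 1) / (r ^ 2 + 1)))
      (k ((r ^ 2 - 1) / (r ^ 2 + 1)) * (4 * r / (r ^ 2 + 1) ^ 2)) r :=
    fun r _ => (hK _).comp r (hasDerivAt_stereographic_height r)
  have hpos : ∀ r ∈ Ioi (0 : ℝ),
      0 ≤ k ((r ^ 2 - 1) / (r ^ 2 + 1)) * (4 * r / (r ^ 2 + 1) ^ 2) := fun r hr =>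
    mul_nonneg (hk _) (div_nonneg (mul_nonneg (by norm_num) (le_of_lt hr)) (by positivity))
  have hlim : Tendsto (fun r : ℝ => K ((r ^ 2 - 1) / (r ^ 2 + 1))) atTop (𝓝 (K 1)) :=
    (hK 1).continuousAt.tendsto.comp tendsto_stereographic_height_atTop
  refine ⟨integrableOn_Ioi_deriv_of_nonneg' hd hpos hlim, ?_⟩
  rw [integral_Ioi_of_hasDerivAt_of_nonneg' hd hpos hlim]
  norm_num

lemma hasDerivAt_arctan_div {a : ℝ} (ha : 0 < a) (t : ℝ) :
    HasDerivAt (fun t => arctan (t / a) / a) (1 / (t ^ 2 + a ^ 2)) t := by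
  refine (((hasDerivAt_id t).div_const a).arctan.div_const a).congr_deriv ?_
  have : t ^ 2 + a ^ 2 ≠ 0 := by positivity
  have : 1 + (t / a) ^ 2 ≠ 0 := by positivity
  simp only [id]
  field_simp
  ring

lemma hasDerivAt_primitive_inv_sq_add_sq_sq {a : ℝ} (ha : 0 < a) (t : ℝ) :
    HasDerivAt (fun t => t / (t ^ 2 + a ^ 2) / (2 * a ^ 2) + arctan (t / a) / a / (2 * a ^ 2))
      (1 / (t ^ 2 + a ^ 2) ^ 2) t := by
  have h : t ^ 2 + a ^ 2 ≠ 0 := by positivity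
  refine ((((hasDerivAt_id t).div ((hasDerivAt_pow 2 t).add_const (a ^ 2)) h).div_const
    (2 * a ^ 2)).add ((hasDerivAt_arctan_div ha t).div_const (2 * a ^ 2))).congr_deriv ?_
  simp only [id, Nat.cast_ofNat, Nat.add_one_sub_one, pow_one]
  field_simp
  ring

lemma pi_div_two_sub_arctan_eq_two_mul_arctan_inv {a : ℝ} (ha : 0 < a) :
    π / 2 - arctan ((a ^ 2 - 1) / (2 * a)) = 2 * arctan (1 / a) := by
  have h0 : 0 < arctan a := arctan_pos.2 ha
  have h1 := arctan_lt_pi_div_two a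
  have hc : arctan (1 / a) = π / 2 - arctan a := by rw [one_div, arctan_inv_of_pos ha]
  have ht : tan (2 * arctan a - π / 2) = (a ^ 2 - 1) / (2 * a) := by
    rw [← neg_sub, tan_neg, tan_pi_div_two_sub, tan_two_mul, tan_arctan, inv_div, ← neg_div,
      neg_sub]
  have : arctan ((a ^ 2 - 1) / (2 * a)) = 2 * arctan a - π / 2 := by
    rw [← ht, arctan_tan] <;> linarith
  rw [this, hc]
  ring

/-- The total sectional curvature `∫ K̂ dμ` of the cmc sphere `S_H` in the Heisenberg
group: the improper integral converges and equals `16π − (4H² − 1/4) A(H)`. -/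
theorem total_sectional_curvature_of_cmc_sphere_in_Nil (H : ℝ) (hH : 0 < H) :
    IntegrableOn
      (fun r : ℝ =>
        (1 / 4 - ((r ^ 2 - 1) / (r ^ 2 + 1)) ^ 2) *
          (16 * (1 + 4 * H ^ 2) * (1 + r ^ 2) ^ 2 /
            ((r ^ 2 - 1) ^ 2 + 4 * H ^ 2 * (r ^ 2 + 1) ^ 2) ^ 2) * r)
      (Ioi (0 : ℝ)) ∧
    2 * π * ∫ r in Ioi (0 : ℝ),
        (1 / 4 - ((r ^ 2 - 1) / (r ^ 2 + 1)) ^ 2) *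
          (16 * (1 + 4 * H ^ 2) * (1 + r ^ 2) ^ 2 /
            ((r ^ 2 - 1) ^ 2 + 4 * H ^ 2 * (r ^ 2 + 1) ^ 2) ^ 2) * r
      = 16 * π -
          (4 * H ^ 2 - 1 / 4) *
            (2 * π * (1 / H ^ 2 +
              (1 + 4 * H ^ 2) / (4 * H ^ 3) *
                (π / 2 - arctan ((4 * H ^ 2 - 1) / (4 * H))))) := by
  have ha : 0 < 2 * H := by positivity
  obtain ⟨i₁, e₁⟩ := integral_comp_stereographic_height
    (hasDerivAt_primitive_inv_sq_add_sq_sq ha) (fun t => by positivity)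
  obtain ⟨i₂, e₂⟩ := integral_comp_stereographic_height
    (hasDerivAt_arctan_div ha) (fun t => by positivity)
  have key : (fun r : ℝ =>
      (1 / 4 - ((r ^ 2 - 1) / (r ^ 2 + 1)) ^ 2) *
        (16 * (1 + 4 * H ^ 2) * (1 + r ^ 2) ^ 2 /
          ((r ^ 2 - 1) ^ 2 + 4 * H ^ 2 * (r ^ 2 + 1) ^ 2) ^ 2) * r) = fun r =>
      4 * (1 + 4 * H ^ 2) * (1 / 4 + 4 * H ^ 2) *
        (1 / (((r ^ 2 - 1) / (r ^ 2 + 1)) ^ 2 + (2 * H) ^ 2) ^ 2 *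
          (4 * r / (r ^ 2 + 1) ^ 2)) -
      4 * (1 + 4 * H ^ 2) *
        (1 / (((r ^ 2 - 1) / (r ^ 2 + 1)) ^ 2 + (2 * H) ^ 2) *
          (4 * r / (r ^ 2 + 1) ^ 2)) := by
    funext r
    have hr : r ^ 2 + 1 ≠ 0 := by positivity
    have hD : (r ^ 2 - 1) ^ 2 + 4 * H ^ 2 * (r ^ 2 + 1) ^ 2 ≠ 0 := by positivity
    have hq : ((r ^ 2 - 1) / (r ^ 2 + 1)) ^ 2 + (2 * H) ^ 2 =
        ((r ^ 2 - 1) ^ 2 + 4 * H ^ 2 * (r ^ 2 + 1) ^ 2) / (r ^ 2 + 1) ^ 2 := by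
      field_simp
      ring
    rw [hq]
    field_simp
    ring
  rw [key]
  refine ⟨(i₁.const_mul _).sub (i₂.const_mul _), ?_⟩
  rw [integral_sub (i₁.const_mul _) (i₂.const_mul _), integral_const_mul, integral_const_mul,
    e₁, e₂]
  have hA : π / 2 - arctan ((4 * H ^ 2 - 1) / (4 * H)) = 2 * arctan (1 / (2 * H)) := by
    rw [← pi_div_two_sub_arctan_eq_two_mul_arctan_inv ha]
    ring_nf
  rw [hA, neg_div (2 * H), arctan_neg]
  have hH1 : 1 + 4 * H ^ 2 ≠ 0 := by positivity
  have hs : (1 : ℝ) ^ 2 + (2 * H) ^ 2 = 1 + 4 * H ^ 2 := by ring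
  have hs' : (-1 : ℝ) ^ 2 + (2 * H) ^ 2 = 1 + 4 * H ^ 2 := by ring
  rw [hs, hs']
  generalize arctan (1 / (2 * H)) = θ
  field_simp
  ring
end

section
/- Let L > 0, let k be an integer, and let u, σ : ℝ → ℝ be continuously differentiable with u(s + L) = u(s) and σ(s + L) = σ(s) + 2πk for all s, u(s) > 0 for all s, and u′(s) = cos(σ(s)) for all s. Then ∫₀^L ( (σ′(s) + sin σ(s)/u(s))²/4 − cos²σ(s)/(4 + u(s)²) ) u(s) √(4 + u(s)²) ds > 0. -/
open Real intervalIntegral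

/-- Completing the square in the spinor-energy density: with `w = √(4 + u²)`, the density is a
manifestly nonnegative term minus the derivative of `(w - 1) cos σ`, where `S`, `C` stand for
`sin σ`, `cos σ` and `p` for `σ′`. -/
lemma spinor_energy_density_eq {u w S C p : ℝ} (hu : 0 < u) (hw : 0 < w)
    (hw2 : w ^ 2 = 4 + u ^ 2) :
    ((p + S / u) ^ 2 / 4 - C ^ 2 / (4 + u ^ 2)) * (u * w) =
      ((p + (2 - w) * S / (u * w)) ^ 2 * (u * w) / 4 + S ^ 2 * (w - 1) / (u * w)) -
        (u * C / w * C + (w - 1) * (-S * p)) := by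
  rw [← hw2]
  field_simp
  ring

/-- For tori of revolution in the Heisenberg group, generated by a closed arclength
parametrized curve `(u(s), v(s))` of period `L` lying in the open half-plane
`u > 0`, with angle function `σ` (periodic up to a multiple of `2π`) satisfying
`u′ = cos σ`, the spinor-energy integral is strictly positive. -/
theorem spinor_energy_tori_of_revolution_pos
    (L : ℝ) (hL : 0 < L) (k : ℤ) (u σ u' σ' : ℝ → ℝ)
    (hu : ∀ s, HasDerivAt u (u' s) s) (hu'cont : Continuous u')
    (hσ : ∀ s, HasDerivAt σ (σ' s) s) (hσ'cont : Continuous σ')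
    (huper : ∀ s, u (s + L) = u s)
    (hσper : ∀ s, σ (s + L) = σ s + 2 * π * k)
    (hupos : ∀ s, 0 < u s)
    (hu'cos : ∀ s, u' s = Real.cos (σ s)) :
    0 < ∫ s in (0:ℝ)..L,
        ((σ' s + Real.sin (σ s) / u s) ^ 2 / 4 -
          Real.cos (σ s) ^ 2 / (4 + u s ^ 2)) *
          (u s * Real.sqrt (4 + u s ^ 2)) := by
  have hw_pos : ∀ s, 0 < √(4 + u s ^ 2) := fun s => by positivity
  have hw_sq : ∀ s, √(4 + u s ^ 2) ^ 2 = 4 + u s ^ 2 := fun s => Real.sq_sqrt (by positivity)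
  have hw_one : ∀ s, 0 < √(4 + u s ^ 2) - 1 := fun s => by
    nlinarith [hw_pos s, hw_sq s, sq_nonneg (u s)]
  have hu_cont : Continuous u := continuous_iff_continuousAt.2 fun s => (hu s).continuousAt
  have hσ_cont : Continuous σ := continuous_iff_continuousAt.2 fun s => (hσ s).continuousAt
  have hw_cont : Continuous fun s => √(4 + u s ^ 2) := by fun_prop
  set G : ℝ → ℝ := fun s =>
    (σ' s + (2 - √(4 + u s ^ 2)) * Real.sin (σ s) / (u s * √(4 + u s ^ 2))) ^ 2 *
        (u s * √(4 + u s ^ 2)) / 4 +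
      Real.sin (σ s) ^ 2 * (√(4 + u s ^ 2) - 1) / (u s * √(4 + u s ^ 2)) with hG
  set D : ℝ → ℝ := fun s =>
    u s * Real.cos (σ s) / √(4 + u s ^ 2) * Real.cos (σ s) +
      (√(4 + u s ^ 2) - 1) * (-Real.sin (σ s) * σ' s) with hD
  have hG_cont : Continuous G := by
    have hne : ∀ s, u s * √(4 + u s ^ 2) ≠ 0 := fun s => (mul_pos (hupos s) (hw_pos s)).ne'
    fun_prop (disch := assumption)
  have hD_cont : Continuous D := by
    have hne : ∀ s, √(4 + u s ^ 2) ≠ 0 := fun s => (hw_pos s).ne'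
    fun_prop (disch := assumption)
  have hD_deriv : ∀ s, HasDerivAt (fun s => (√(4 + u s ^ 2) - 1) * Real.cos (σ s)) (D s) s := by
    intro s
    have h_ne : 4 + u s ^ 2 ≠ 0 := by positivity
    have h := (((((hu s).fun_pow 2).const_add 4).sqrt h_ne).sub_const 1).fun_mul (hσ s).cos
    refine h.congr_deriv ?_
    have := (hw_pos s).ne'
    simp only [hD, hu'cos s]
    field_simp
    ring
  have hD_int : ∫ s in (0 : ℝ)..L, D s = 0 := by
    rw [integral_eq_sub_of_hasDerivAt (fun s _ => hD_deriv s) (hD_cont.intervalIntegrable _ _)]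
    have hu0 := huper 0
    have hσ0 := hσper 0
    rw [zero_add] at hu0 hσ0
    rw [hu0, hσ0, mul_comm (2 * π), Real.cos_add_int_mul_two_pi, sub_self]
  simp_rw [fun s => spinor_energy_density_eq (S := Real.sin (σ s)) (C := Real.cos (σ s))
    (p := σ' s) (hupos s) (hw_pos s) (hw_sq s)]
  change 0 < ∫ s in (0 : ℝ)..L, (G s - D s)
  rw [integral_sub (hG_cont.intervalIntegrable _ _) (hD_cont.intervalIntegrable _ _), hD_int,
    sub_zero]
  refine integral_pos hL hG_cont.continuousOn (fun s _ => ?_) ?_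
  · have := hupos s
    have := hw_one s
    positivity
  · obtain ⟨c, hc, hc0⟩ := exists_hasDerivAt_eq_zero hL hu_cont.continuousOn
      (by simpa using (huper 0).symm) (fun s _ => hu s)
    refine ⟨c, Set.Ioo_subset_Icc_self hc, ?_⟩
    have hsin : Real.sin (σ c) ^ 2 = 1 := by
      have := Real.sin_sq_add_cos_sq (σ c)
      rw [← hu'cos, hc0] at this
      simpa using this
    have := hupos c
    have := hw_one c
    simp only [hG, hsin]
    positivity
end
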